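/- With p : Ũ → U the universal discrete fibration of groupoids with involution defined from pairs of κ-small sets with a bijection (as in the paper), a morphism f : A → B of groupoids with involution is a pullback of p (i.e. fits in a pullback square over p) if and only if the underlying functor of f is a discrete fibration of groupoids with fibers of cardinality < κ. -/

import Mathlib

open CategoryTheory

universe w v u

structure GpdInv where
  carrier : Type u
  [str : Groupoid.{v} carrier]
  inv : carrier ⥤ carrier
  inv_inv : inv ⋙ inv = 𝟭 carrier

attribute [instance] GpdInv.str

/-- An equivariant functor between groupoids with involution. -/
def GpdInv.Equivariant (A B : GpdInv) (f : A.carrier ⥤ B.carrier) : Prop :=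
  A.inv ⋙ f = f ⋙ B.inv

/-- A fixed point of the involution. -/
def GpdInv.Fixed (A : GpdInv) (x : A.carrier) : Prop := A.inv.obj x = x
instance : Category GpdInv.{v, u} where
  Hom A B := {f : A.carrier ⥤ B.carrier // GpdInv.Equivariant A B f}
  id A := ⟨𝟭 A.carrier, by
    show A.inv ⋙ 𝟭 A.carrier = 𝟭 A.carrier ⋙ A.inv
    rw [Functor.comp_id, Functor.id_comp]⟩
  comp {A B C} f g := ⟨f.1 ⋙ g.1, by
    show A.inv ⋙ f.1 ⋙ g.1 = (f.1 ⋙ g.1) ⋙ C.inv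
    rw [← Functor.assoc, show A.inv ⋙ f.1 = f.1 ⋙ B.inv from f.2, Functor.assoc,
      show B.inv ⋙ g.1 = g.1 ⋙ C.inv from g.2, Functor.assoc]⟩
  id_comp f := Subtype.ext (Functor.id_comp _)
  comp_id f := Subtype.ext (Functor.comp_id _)
  assoc f g h := Subtype.ext (Functor.assoc _ _ _)

/-- Discrete fibration: unique lifting of isomorphisms along a given domain object. -/
def IsDiscFib {A B : Type*} [Category A] [Category B] (f : A ⥤ B) : Prop :=
  ∀ (x : A) (b : B) (φ : f.obj x ≅ b),
    ∃! l : Σ y : A, x ≅ y, ∃ h : f.obj l.1 = b, f.map l.2.hom = φ.hom ≫ eqToHom h.symm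

/-- An object of the universe U : a pair of κ-small sets with a bijection. -/
structure UObj (κ : Cardinal.{u}) where
  A : Type u
  B : Type u
  hA : Cardinal.mk A < κ
  hB : Cardinal.mk B < κ
  e : A ≃ B

instance {κ : Cardinal.{u}} : Groupoid (UObj κ) where
  Hom X Y := {p : (X.A ≃ Y.A) × (X.B ≃ Y.B) // ∀ a, Y.e (p.1 a) = p.2 (X.e a)}
  id X := ⟨(Equiv.refl _, Equiv.refl _), fun _ => rfl⟩
  comp {X Y Z} p q := ⟨(p.1.1.trans q.1.1, p.1.2.trans q.1.2), fun a => by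
    simp only [Equiv.trans_apply]; rw [q.2, p.2]⟩
  id_comp p := Subtype.ext (Prod.ext (Equiv.refl_trans _) (Equiv.refl_trans _))
  comp_id p := Subtype.ext (Prod.ext (Equiv.trans_refl _) (Equiv.trans_refl _))
  assoc p q r := Subtype.ext (Prod.ext (Equiv.trans_assoc _ _ _).symm (Equiv.trans_assoc _ _ _).symm)
  inv {X Y} p := ⟨(p.1.1.symm, p.1.2.symm), fun a => p.1.2.injective (by
    rw [← p.2, Equiv.apply_symm_apply, Equiv.apply_symm_apply])⟩
  inv_comp p := Subtype.ext (Prod.ext (Equiv.symm_trans_self _) (Equiv.symm_trans_self _))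
  comp_inv p := Subtype.ext (Prod.ext (Equiv.self_trans_symm _) (Equiv.self_trans_symm _))

/-- The involution on U : swap the two sets. -/
def Uinv (κ : Cardinal.{u}) : UObj κ ⥤ UObj κ where
  obj X := ⟨X.B, X.A, X.hB, X.hA, X.e.symm⟩
  map {X Y} p := ⟨(p.1.2, p.1.1), fun b => Y.e.symm_apply_eq.mpr (by
    rw [p.2, Equiv.apply_symm_apply])⟩
  map_id _ := Subtype.ext rfl
  map_comp _ _ := Subtype.ext rfl

/-- An object of the universe Ũ : a pair of κ-small sets with a bijection and a
point (recorded symmetrically by its matched pair). -/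
structure UtObj (κ : Cardinal.{u}) extends UObj κ where
  pt : A
  pt2 : B
  hpt : e pt = pt2

instance {κ : Cardinal.{u}} : Groupoid (UtObj κ) where
  Hom X Y := {p : X.toUObj ⟶ Y.toUObj // p.1.1 X.pt = Y.pt}
  id X := ⟨𝟙 X.toUObj, rfl⟩
  comp {X Y Z} p q := ⟨p.1 ≫ q.1, by
    show q.1.1.1 (p.1.1.1 X.pt) = Z.pt
    rw [p.2, q.2]⟩
  id_comp p := Subtype.ext (Category.id_comp _)
  comp_id p := Subtype.ext (Category.comp_id _)
  assoc p q r := Subtype.ext (Category.assoc _ _ _)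
  inv {X Y} p := ⟨Groupoid.inv p.1, p.1.1.1.symm_apply_eq.mpr p.2.symm⟩
  inv_comp p := Subtype.ext (Groupoid.inv_comp _)
  comp_inv p := Subtype.ext (Groupoid.comp_inv _)

/-- The involution on Ũ. -/
def Utinv (κ : Cardinal.{u}) : UtObj κ ⥤ UtObj κ where
  obj X := ⟨⟨X.B, X.A, X.hB, X.hA, X.e.symm⟩, X.pt2, X.pt, by
    rw [← X.hpt, Equiv.symm_apply_apply]⟩
  map {X Y} p := ⟨(Uinv κ).map p.1, by
    show p.1.1.2 X.pt2 = Y.pt2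
    rw [← X.hpt, ← p.1.2, p.2, Y.hpt]⟩
  map_id _ := Subtype.ext rfl
  map_comp _ _ := Subtype.ext rfl

/-- The universal fibration p : Ũ → U, forgetting the point. -/
def pFun (κ : Cardinal.{u}) : UtObj κ ⥤ UObj κ where
  obj X := X.toUObj
  map p := p.1

/-- U as a groupoid with involution. -/
def UGpd (κ : Cardinal.{u}) : GpdInv.{u, u + 1} :=
  { carrier := UObj κ, inv := Uinv κ, inv_inv := rfl }

/-- Ũ as a groupoid with involution. -/
def UtGpd (κ : Cardinal.{u}) : GpdInv.{u, u + 1} :=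
  { carrier := UtObj κ, inv := Utinv κ, inv_inv := rfl }

/-- The universal fibration p : Ũ → U as a morphism of groupoids with involution. -/
def pMor (κ : Cardinal.{u}) : UtGpd κ ⟶ UGpd κ := ⟨pFun κ, rfl⟩

/-! ### Heterogeneous equality of morphisms -/

section HEqLemmas

variable {C : Type*} [Category C] {D : Type*} [Category D]

theorem heq_comp_of_heq {a b c a' b' c' : C} {f : a ⟶ b} {h : b ⟶ c} {f' : a' ⟶ b'}
    {h' : b' ⟶ c'} (ea : a = a') (eb : b = b') (ec : c = c') (hf : HEq f f') (hh : HEq h h') :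
    HEq (f ≫ h) (f' ≫ h') := by
  subst ea eb ec hf hh; rfl

theorem heq_id_of_eq {a a' : C} (ea : a = a') : HEq (𝟙 a) (𝟙 a') := by
  subst ea; rfl

theorem heq_map_of_heq (F : C ⥤ D) {a b a' b' : C} {f : a ⟶ b} {f' : a' ⟶ b'}
    (ea : a = a') (eb : b = b') (hf : HEq f f') : HEq (F.map f) (F.map f') := by
  subst ea eb hf; rfl

theorem heq_groupoid_inv {G : Type*} [Groupoid G] {a b a' b' : G} {f : a ⟶ b} {f' : a' ⟶ b'}
    (ea : a = a') (eb : b = b') (hf : HEq f f') : HEq (Groupoid.inv f) (Groupoid.inv f') := by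
  subst ea eb hf; rfl

end HEqLemmas

/-! ### Strict pullbacks of groupoids with involution -/

/-- The square `t ⋙ p = f ⋙ g` exhibits its corner as the strict pullback, expressed
elementwise on objects and morphisms. -/
structure IsStrictPullback {X Y Z W : Type*} [Category X] [Category Y] [Category Z] [Category W]
    (t : X ⥤ Z) (f : X ⥤ Y) (p : Z ⥤ W) (g : Y ⥤ W) : Prop where
  comm : t ⋙ p = f ⋙ g
  exists_obj : ∀ y z, p.obj z = g.obj y → ∃ x, f.obj x = y ∧ t.obj x = z
  obj_ext : ∀ x x', f.obj x = f.obj x' → t.obj x = t.obj x' → x = x'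
  exists_map : ∀ x x' (m : f.obj x ⟶ f.obj x') (q : t.obj x ⟶ t.obj x'),
    HEq (p.map q) (g.map m) → ∃ n : x ⟶ x', f.map n = m ∧ t.map n = q
  map_ext : ∀ x x' (n n' : x ⟶ x'), f.map n = f.map n' → t.map n = t.map n' → n = n'

namespace IsStrictPullback

variable {X Y Z W : Type*} [Category X] [Category Y] [Category Z] [Category W]
  {t : X ⥤ Z} {f : X ⥤ Y} {p : Z ⥤ W} {g : Y ⥤ W}

theorem functor_ext (H : IsStrictPullback t f p g) {V : Type*} [Category V] {L L' : V ⥤ X}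
    (hf : L ⋙ f = L' ⋙ f) (ht : L ⋙ t = L' ⋙ t) : L = L' := by
  have hobj : ∀ v, L.obj v = L'.obj v := fun v =>
    H.obj_ext _ _ (Functor.congr_obj hf v) (Functor.congr_obj ht v)
  have key : ∀ {x x' y y' : X} (n : x ⟶ x') (n' : y ⟶ y'), x = y → x' = y' →
      HEq (f.map n) (f.map n') → HEq (t.map n) (t.map n') → HEq n n' := by
    rintro x x' _ _ n n' rfl rfl h h'
    exact heq_of_eq (H.map_ext _ _ _ _ (eq_of_heq h) (eq_of_heq h'))
  exact Functor.hext hobj fun v v' n => key _ _ (hobj v) (hobj v')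
    (Functor.hcongr_hom hf n) (Functor.hcongr_hom ht n)

theorem exists_map_heq (H : IsStrictPullback t f p g) {x x' : X} {y y' : Y} {z z' : Z}
    (m : y ⟶ y') (q : z ⟶ z') (hy : f.obj x = y) (hy' : f.obj x' = y') (hz : t.obj x = z)
    (hz' : t.obj x' = z') (h : HEq (p.map q) (g.map m)) :
    ∃ n : x ⟶ x', HEq (f.map n) m ∧ HEq (t.map n) q := by
  subst hy hy' hz hz'
  obtain ⟨n, rfl, rfl⟩ := H.exists_map _ _ m q h
  exact ⟨n, HEq.rfl, HEq.rfl⟩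

theorem exists_lift (H : IsStrictPullback t f p g) {V : Type*} [Category V] (s : V ⥤ Z)
    (k : V ⥤ Y) (w : s ⋙ p = k ⋙ g) : ∃ L : V ⥤ X, L ⋙ t = s ∧ L ⋙ f = k := by
  choose o hof hot using fun v => H.exists_obj (k.obj v) (s.obj v) (Functor.congr_obj w v)
  choose l hlf hlt using fun (v v' : V) (n : v ⟶ v') =>
    H.exists_map_heq (k.map n) (s.map n) (hof v) (hof v') (hot v) (hot v')
      (Functor.hcongr_hom w n)
  refine ⟨{ obj := o
            map := fun {v v'} n => l v v' n
            map_id := fun v => ?_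
            map_comp := fun {a b c} n n' => ?_ }, ?_, ?_⟩
  · apply H.map_ext
    · refine eq_of_heq ((hlf _ _ _).trans ?_)
      rw [k.map_id, f.map_id]
      exact heq_id_of_eq (hof v).symm
    · refine eq_of_heq ((hlt _ _ _).trans ?_)
      rw [s.map_id, t.map_id]
      exact heq_id_of_eq (hot v).symm
  · apply H.map_ext
    · refine eq_of_heq ((hlf _ _ _).trans ?_)
      rw [k.map_comp, f.map_comp]
      exact heq_comp_of_heq (hof a).symm (hof b).symm (hof c).symm (hlf _ _ n).symm
        (hlf _ _ n').symm
    · refine eq_of_heq ((hlt _ _ _).trans ?_)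
      rw [s.map_comp, t.map_comp]
      exact heq_comp_of_heq (hot a).symm (hot b).symm (hot c).symm (hlt _ _ n).symm
        (hlt _ _ n').symm
  · exact Functor.hext hot fun _ _ n => hlt _ _ n
  · exact Functor.hext hof fun _ _ n => hlf _ _ n

end IsStrictPullback

theorem GpdInv.comp_val {A B C : GpdInv.{v, u}} (f : A ⟶ B) (g : B ⟶ C) :
    (f ≫ g).1 = f.1 ⋙ g.1 := rfl

theorem GpdInv.hom_comm {A B : GpdInv.{v, u}} (f : A ⟶ B) : A.inv ⋙ f.1 = f.1 ⋙ B.inv := f.2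

theorem IsStrictPullback.isPullback {X Y Z W : GpdInv.{v, u}} {t : X ⟶ Z} {f : X ⟶ Y}
    {p : Z ⟶ W} {g : Y ⟶ W} (H : IsStrictPullback t.1 f.1 p.1 g.1) : IsPullback t f p g := by
  have key : ∀ s : Limits.PullbackCone p g, ∃ L : s.pt ⟶ X, L ≫ t = s.fst ∧ L ≫ f = s.snd := by
    intro s
    obtain ⟨L, hLt, hLf⟩ := H.exists_lift s.fst.1 s.snd.1 (congrArg Subtype.val s.condition)
    refine ⟨⟨L, H.functor_ext ?_ ?_⟩, Subtype.ext hLt, Subtype.ext hLf⟩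
    · rw [Functor.assoc, Functor.assoc, GpdInv.hom_comm f, hLf, ← Functor.assoc, hLf,
        GpdInv.hom_comm s.snd]
    · rw [Functor.assoc, Functor.assoc, GpdInv.hom_comm t, hLt, ← Functor.assoc, hLt,
        GpdInv.hom_comm s.fst]
  choose L hLt hLf using key
  refine ⟨⟨Subtype.ext H.comm⟩, ⟨Limits.PullbackCone.IsLimit.mk _ L hLt hLf ?_⟩⟩
  intro s m hm hm'
  refine Subtype.ext (H.functor_ext ?_ ?_)
  · rw [← GpdInv.comp_val, ← GpdInv.comp_val, hm', hLf]
  · rw [← GpdInv.comp_val, ← GpdInv.comp_val, hm, hLt]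

/-- Objects of the strict pullback of two functors. -/
structure StrictPullback {Y Z W : Type*} [Category Y] [Category Z] [Category W]
    (p : Z ⥤ W) (g : Y ⥤ W) where
  base : Y
  pt : Z
  eq : p.obj pt = g.obj base

namespace StrictPullback

variable {Y Z W : Type*} [Groupoid Y] [Groupoid Z] [Groupoid W] (p : Z ⥤ W) (g : Y ⥤ W)

instance : Groupoid (StrictPullback p g) where
  Hom a b := {r : (a.base ⟶ b.base) × (a.pt ⟶ b.pt) // HEq (p.map r.2) (g.map r.1)}
  id a := ⟨(𝟙 _, 𝟙 _), by
    rw [p.map_id, g.map_id]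
    exact heq_id_of_eq a.eq⟩
  comp {a b c} r s := ⟨(r.1.1 ≫ s.1.1, r.1.2 ≫ s.1.2), by
    simp only [Functor.map_comp]
    exact heq_comp_of_heq a.eq b.eq c.eq r.2 s.2⟩
  id_comp r := Subtype.ext (Prod.ext (Category.id_comp _) (Category.id_comp _))
  comp_id r := Subtype.ext (Prod.ext (Category.comp_id _) (Category.comp_id _))
  assoc r s q := Subtype.ext (Prod.ext (Category.assoc _ _ _) (Category.assoc _ _ _))
  inv {a b} r := ⟨(Groupoid.inv r.1.1, Groupoid.inv r.1.2), by
    have h := heq_groupoid_inv a.eq b.eq r.2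
    simpa only [Groupoid.inv_eq_inv, Functor.map_inv] using h⟩
  inv_comp r := Subtype.ext (Prod.ext (Groupoid.inv_comp _) (Groupoid.inv_comp _))
  comp_inv r := Subtype.ext (Prod.ext (Groupoid.comp_inv _) (Groupoid.comp_inv _))

/-- The projection to the base. -/
def fst : StrictPullback p g ⥤ Y where
  obj a := a.base
  map r := r.1.1

/-- The projection to the total space. -/
def snd : StrictPullback p g ⥤ Z where
  obj a := a.pt
  map r := r.1.2

theorem isStrictPullback : IsStrictPullback (snd p g) (fst p g) p g where
  comm := Functor.hext (fun a => a.eq) fun _ _ r => r.2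
  exists_obj y z h := ⟨⟨y, z, h⟩, rfl, rfl⟩
  obj_ext := by
    rintro ⟨y, z, h⟩ ⟨y', z', h'⟩ (rfl : y = y') (rfl : z = z')
    rfl
  exists_map _ _ m q h := ⟨⟨(m, q), h⟩, rfl, rfl⟩
  map_ext _ _ _ _ h h' := Subtype.ext (Prod.ext h h')

end StrictPullback

/-- The strict pullback of groupoids with involution. -/
def GpdInv.strictPullback {Y Z W : GpdInv.{v, u}} (p : Z ⟶ W) (g : Y ⟶ W) : GpdInv.{v, u} where
  carrier := StrictPullback p.1 g.1
  inv :=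
    { obj := fun a => ⟨Y.inv.obj a.base, Z.inv.obj a.pt, by
        have h₁ := Functor.congr_obj (GpdInv.hom_comm p) a.pt
        have h₂ := Functor.congr_obj (GpdInv.hom_comm g) a.base
        simp only [Functor.comp_obj] at h₁ h₂
        rw [h₁, h₂, a.eq]⟩
      map := fun {a b} r => ⟨(Y.inv.map r.1.1, Z.inv.map r.1.2),
        (Functor.hcongr_hom (GpdInv.hom_comm p) r.1.2).trans
          ((heq_map_of_heq W.inv a.eq b.eq r.2).trans
            (Functor.hcongr_hom (GpdInv.hom_comm g) r.1.1).symm)⟩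
      map_id := fun a => Subtype.ext (Prod.ext (Y.inv.map_id _) (Z.inv.map_id _))
      map_comp := fun r s => Subtype.ext (Prod.ext (Y.inv.map_comp _ _) (Z.inv.map_comp _ _)) }
  inv_inv := (StrictPullback.isStrictPullback p.1 g.1).functor_ext
    (congrArg (StrictPullback.fst p.1 g.1 ⋙ ·) Y.inv_inv)
    (congrArg (StrictPullback.snd p.1 g.1 ⋙ ·) Z.inv_inv)

/-- The projection of the strict pullback to the base. -/
def GpdInv.strictPullbackFst {Y Z W : GpdInv.{v, u}} (p : Z ⟶ W) (g : Y ⟶ W) :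
    GpdInv.strictPullback p g ⟶ Y := ⟨StrictPullback.fst p.1 g.1, rfl⟩

/-- The projection of the strict pullback to the total space. -/
def GpdInv.strictPullbackSnd {Y Z W : GpdInv.{v, u}} (p : Z ⟶ W) (g : Y ⟶ W) :
    GpdInv.strictPullback p g ⟶ Z := ⟨StrictPullback.snd p.1 g.1, rfl⟩

theorem GpdInv.isPullback_strictPullback {Y Z W : GpdInv.{v, u}} (p : Z ⟶ W) (g : Y ⟶ W) :
    IsPullback (GpdInv.strictPullbackSnd p g) (GpdInv.strictPullbackFst p g) p g :=
  IsStrictPullback.isPullback (StrictPullback.isStrictPullback p.1 g.1)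

/-! ### Discrete fibrations -/

/-- The action of a functor on the isomorphisms out of a given object. -/
def isoMapFrom {A B : Type*} [Category A] [Category B] (f : A ⥤ B) (x : A)
    (l : Σ y : A, x ≅ y) : Σ b : B, f.obj x ≅ b := ⟨f.obj l.1, f.mapIso l.2⟩

theorem isDiscFib_iff_bijective {A B : Type*} [Category A] [Category B] (f : A ⥤ B) :
    IsDiscFib f ↔ ∀ x, Function.Bijective (isoMapFrom f x) := by
  have key : ∀ (x : A) (b : B) (φ : f.obj x ≅ b) (l : Σ y : A, x ≅ y),
      (∃ h : f.obj l.1 = b, f.map l.2.hom = φ.hom ≫ eqToHom h.symm) ↔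
        isoMapFrom f x l = ⟨b, φ⟩ := by
    rintro x b φ ⟨y, l⟩
    constructor
    · rintro ⟨h, e⟩
      change f.obj y = b at h
      subst h
      refine Sigma.ext rfl (heq_of_eq (Iso.ext ?_))
      simpa [isoMapFrom] using e
    · intro h
      obtain ⟨rfl, h₂⟩ := Sigma.mk.inj h
      obtain rfl := eq_of_heq h₂
      exact ⟨rfl, by simp⟩
  refine forall_congr' fun x => ?_
  rw [Function.bijective_iff_existsUnique]
  constructor
  · rintro H ⟨b, φ⟩
    simpa only [key] using H b φ
  · intro H b φ
    simpa only [key] using H ⟨b, φ⟩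

theorem IsDiscFib.comp {A B C : Type*} [Category A] [Category B] [Category C] {f : A ⥤ B}
    {g : B ⥤ C} (hf : IsDiscFib f) (hg : IsDiscFib g) : IsDiscFib (f ⋙ g) := by
  rw [isDiscFib_iff_bijective] at *
  exact fun x => (hg (f.obj x)).comp (hf x)

theorem isDiscFib_of_inverse {A B : Type*} [Category A] [Category B] {f : A ⥤ B} {f' : B ⥤ A}
    (h : f ⋙ f' = 𝟭 A) (h' : f' ⋙ f = 𝟭 B) : IsDiscFib f := by
  let e : A ≌ B := CategoryTheory.Equivalence.mk f f' (eqToIso h.symm) (eqToIso h')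
  have : f.IsEquivalence := e.isEquivalence_functor
  rw [isDiscFib_iff_bijective]
  refine fun x => ⟨?_, ?_⟩
  · rintro ⟨y, l⟩ ⟨y', l'⟩ hl
    obtain ⟨h₁, h₂⟩ := Sigma.mk.inj hl
    have hy : y = y' := by
      have := congrArg f'.obj h₁
      exact (Functor.congr_obj h y).symm.trans (this.trans (Functor.congr_obj h y'))
    subst hy
    exact Sigma.ext rfl (heq_of_eq (f.mapIso_injective (eq_of_heq h₂)))
  · rintro ⟨b, φ⟩
    obtain ⟨y, rfl⟩ : ∃ y, f.obj y = b := ⟨f'.obj b, Functor.congr_obj h' b⟩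
    exact ⟨⟨y, f.preimageIso φ⟩, Sigma.ext rfl (heq_of_eq (Iso.ext (f.map_preimage φ.hom)))⟩

section Universal

variable {κ : Cardinal.{u}}

theorem UObj.hom_ext {a b : UObj κ} {m n : a ⟶ b} (h : m.1.1 = n.1.1) : m = n := by
  refine Subtype.ext (Prod.ext h (Equiv.ext fun c => ?_))
  obtain ⟨c, rfl⟩ := a.e.surjective c
  rw [← m.2, ← n.2, h]

theorem UObj.hom_heq {a b a' b' : UObj κ} {m : a ⟶ b} {n : a' ⟶ b'} (ha : a = a') (hb : b = b')
    (h : HEq m.1.1 n.1.1) : HEq m n := by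
  subst ha hb
  exact heq_of_eq (UObj.hom_ext (eq_of_heq h))

theorem UtObj.ext_of_heq {a b : UtObj κ} (h : a.toUObj = b.toUObj) (hpt : HEq a.pt b.pt) :
    a = b := by
  obtain ⟨a, x, _, rfl⟩ := a
  obtain ⟨b, y, _, rfl⟩ := b
  obtain rfl : a = b := h
  obtain rfl : x = y := eq_of_heq hpt
  rfl

theorem UtObj.hom_heq {a b a' b' : UtObj κ} {m : a ⟶ b} {n : a' ⟶ b'} (ha : a = a')
    (hb : b = b') (h : HEq m.1 n.1) : HEq m n := by
  subst ha hb
  exact heq_of_eq (Subtype.ext (eq_of_heq h))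

theorem UtObj.functor_ext {C : Type*} [Category C] {F G : C ⥤ UtObj κ}
    (h : F ⋙ pFun κ = G ⋙ pFun κ) (hpt : ∀ c, HEq (F.obj c).pt (G.obj c).pt) : F = G := by
  have hobj : ∀ c, F.obj c = G.obj c := fun c =>
    UtObj.ext_of_heq (Functor.congr_obj h c) (hpt c)
  exact Functor.hext hobj fun c d m =>
    UtObj.hom_heq (hobj c) (hobj d) (Functor.hcongr_hom h m)

theorem isDiscFib_strictPullback_fst {Y : Type*} [Groupoid Y] (g : Y ⥤ UObj κ) :
    IsDiscFib (StrictPullback.fst (pFun κ) g) := by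
  rw [isDiscFib_iff_bijective]
  rintro ⟨y, ⟨a, x, _, rfl⟩, h⟩
  change a = g.obj y at h
  subst h
  refine ⟨?_, ?_⟩
  · rintro ⟨⟨y₁, ⟨a₁, x₁, _, rfl⟩, h₁⟩, l₁⟩ ⟨⟨y₂, ⟨a₂, x₂, _, rfl⟩, h₂⟩, l₂⟩ hl
    change a₁ = g.obj y₁ at h₁
    change a₂ = g.obj y₂ at h₂
    subst h₁ h₂
    obtain ⟨e, e'⟩ := Sigma.mk.inj hl
    change y₁ = y₂ at e
    subst e
    have e'' : l₁.hom.1.1 = l₂.hom.1.1 := congrArg Iso.hom (eq_of_heq e')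
    have q₁ : l₁.hom.1.2.1 = g.map l₁.hom.1.1 := eq_of_heq l₁.hom.2
    have q₂ : l₂.hom.1.2.1 = g.map l₂.hom.1.1 := eq_of_heq l₂.hom.2
    have q : l₁.hom.1.2.1 = l₂.hom.1.2.1 := by rw [q₁, q₂, e'']
    have p₁ := l₁.hom.1.2.2
    have p₂ := l₂.hom.1.2.2
    rw [q] at p₁
    obtain rfl : x₁ = x₂ := p₁.symm.trans p₂
    exact Sigma.ext rfl (heq_of_eq (Iso.ext (Subtype.ext (Prod.ext e'' (Subtype.ext q)))))
  · rintro ⟨b, φ⟩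
    change y ≅ b at φ
    let z : StrictPullback (pFun κ) g :=
      ⟨b, ⟨g.obj b, (g.map φ.hom).1.1 x, _, rfl⟩, rfl⟩
    let r : (⟨y, ⟨g.obj y, x, _, rfl⟩, rfl⟩ : StrictPullback (pFun κ) g) ⟶ z :=
      ⟨(φ.hom, ⟨g.map φ.hom, rfl⟩), HEq.rfl⟩
    exact ⟨⟨z, (Groupoid.isoEquivHom _ _).symm r⟩,
      Sigma.ext rfl (heq_of_eq (Iso.ext rfl))⟩

theorem mk_fiber_strictPullback_fst_lt {Y : Type (u + 1)} [Groupoid.{u} Y] (g : Y ⥤ UObj κ)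
    (b : Y) : Cardinal.mk {x // (StrictPullback.fst (pFun κ) g).obj x = b} <
      Cardinal.lift.{u + 1} κ := by
  have hA := Cardinal.lift_strictMono.{u, u + 1} (g.obj b).hA
  refine lt_of_le_of_lt ?_ hA
  rw [← Cardinal.mk_uLift]
  refine Cardinal.mk_le_of_injective
    (f := fun x => ⟨cast (congrArg UObj.A (x.1.eq.trans (congrArg g.obj x.2))) x.1.pt.pt⟩) ?_
  rintro ⟨⟨y₁, ⟨a₁, x₁, _, rfl⟩, h₁⟩, rfl⟩ ⟨⟨y₂, ⟨a₂, x₂, _, rfl⟩, h₂⟩, e⟩ hx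
  change y₂ = y₁ at e
  subst e
  change a₁ = g.obj y₂ at h₁
  change a₂ = g.obj y₂ at h₂
  subst h₁ h₂
  obtain rfl : x₁ = x₂ := congrArg ULift.down hx
  rfl

theorem isDiscFib_of_isPullback {X Y : GpdInv.{u, u + 1}} {f : X ⟶ Y} {g : Y ⟶ UGpd κ}
    {t : X ⟶ UtGpd κ} (H : IsPullback t f (pMor κ) g) :
    IsDiscFib f.1 ∧ ∀ b : Y.carrier, Cardinal.mk {x : X.carrier // f.1.obj x = b} <
      Cardinal.lift.{u + 1} κ := by
  have P := GpdInv.isPullback_strictPullback (pMor κ) g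
  let e := H.isoIsPullback _ _ P
  have he : e.hom ≫ GpdInv.strictPullbackFst (pMor κ) g = f := H.isoIsPullback_hom_snd _ _ P
  have h₁ : e.hom.1 ⋙ e.inv.1 = 𝟭 X.carrier := congrArg Subtype.val e.hom_inv_id
  have h₂ : e.inv.1 ⋙ e.hom.1 = 𝟭 (GpdInv.strictPullback (pMor κ) g).carrier :=
    congrArg Subtype.val e.inv_hom_id
  rw [← he]
  refine ⟨(isDiscFib_of_inverse h₁ h₂).comp (isDiscFib_strictPullback_fst (κ := κ) g.1), fun b => ?_⟩
  refine lt_of_le_of_lt (Cardinal.mk_le_of_injective (f := fun x =>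
    (⟨e.hom.1.obj x.1, x.2⟩ : {x : (GpdInv.strictPullback (pMor κ) g).carrier //
      (GpdInv.strictPullbackFst (pMor κ) g).1.obj x = b})) ?_)
    (mk_fiber_strictPullback_fst_lt (κ := κ) g.1 b)
  rintro ⟨x, hx⟩ ⟨x', hx'⟩ h
  have h' : e.hom.1.obj x = e.hom.1.obj x' := congrArg Subtype.val h
  have := congrArg e.inv.1.obj h'
  exact Subtype.ext ((Functor.congr_obj h₁ x).symm.trans (this.trans (Functor.congr_obj h₁ x')))

end Universal

/-! ### Transport between the fibers of a discrete fibration -/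

section Fibers

variable {X Y : Type*} [Groupoid X] [Groupoid Y]

/-- The strict fiber of a functor over an object. -/
abbrev ObjFiber (f : X ⥤ Y) (y : Y) := {x : X // f.obj x = y}

/-- The relation between fibers given by the morphisms lying over `m`. -/
def FiberRel (f : X ⥤ Y) {y y' : Y} (m : y ⟶ y') (a : ObjFiber f y) (b : ObjFiber f y') : Prop :=
  ∃ n : a.1 ⟶ b.1, f.map n = eqToHom a.2 ≫ m ≫ eqToHom b.2.symm

theorem FiberRel.id (f : X ⥤ Y) {y : Y} (a : ObjFiber f y) : FiberRel f (𝟙 y) a a :=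
  ⟨𝟙 _, by simp⟩

theorem FiberRel.comp {f : X ⥤ Y} {y y' y'' : Y} {m : y ⟶ y'} {m' : y' ⟶ y''}
    {a : ObjFiber f y} {b : ObjFiber f y'} {c : ObjFiber f y''} (h : FiberRel f m a b)
    (h' : FiberRel f m' b c) : FiberRel f (m ≫ m') a c := by
  obtain ⟨n, hn⟩ := h
  obtain ⟨n', hn'⟩ := h'
  exact ⟨n ≫ n', by simp [hn, hn']⟩

theorem IsDiscFib.existsUnique_fiberRel {f : X ⥤ Y} (hf : IsDiscFib f) {y y' : Y} (m : y ⟶ y')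
    (a : ObjFiber f y) : ∃! b, FiberRel f m a b := by
  rw [isDiscFib_iff_bijective] at hf
  obtain ⟨a, rfl⟩ := a
  obtain ⟨⟨x', l⟩, hl⟩ := (hf a).2 ⟨y', (Groupoid.isoEquivHom _ _).symm m⟩
  obtain ⟨rfl, h₂⟩ := Sigma.mk.inj hl
  have h₃ : f.map l.hom = m := congrArg Iso.hom (eq_of_heq h₂)
  refine ⟨⟨x', rfl⟩, ⟨l.hom, by simpa using h₃⟩, ?_⟩
  rintro ⟨x'', e⟩ ⟨n, hn⟩
  have := (hf a).1 (a₁ := ⟨x'', (Groupoid.isoEquivHom _ _).symm n⟩) (a₂ := ⟨x', l⟩)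
    (Sigma.ext e ?_)
  · exact Subtype.ext (congrArg Sigma.fst this)
  · have key : ∀ {z z' : Y} (i : f.obj a ≅ z) (j : f.obj a ≅ z') (h : z = z'),
        i.hom = j.hom ≫ eqToHom h.symm → HEq i j := by
      rintro z _ i j rfl h
      exact heq_of_eq (Iso.ext (by simpa using h))
    refine key _ _ e ?_
    simpa [isoMapFrom, h₃] using hn

theorem IsDiscFib.map_injective {f : X ⥤ Y} (hf : IsDiscFib f) {x x' : X} {n n' : x ⟶ x'}
    (h : f.map n = f.map n') : n = n' := by
  rw [isDiscFib_iff_bijective] at hf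
  have := (hf x).1 (a₁ := ⟨x', (Groupoid.isoEquivHom _ _).symm n⟩)
    (a₂ := ⟨x', (Groupoid.isoEquivHom _ _).symm n'⟩) (Sigma.ext rfl (heq_of_eq (Iso.ext h)))
  exact congrArg Iso.hom (eq_of_heq (Sigma.mk.inj this).2)

/-- The transport function between fibers of a discrete fibration. -/
noncomputable def IsDiscFib.transport {f : X ⥤ Y} (hf : IsDiscFib f) {y y' : Y} (m : y ⟶ y')
    (a : ObjFiber f y) : ObjFiber f y' := (hf.existsUnique_fiberRel m a).choose

theorem IsDiscFib.transport_eq_iff {f : X ⥤ Y} (hf : IsDiscFib f) {y y' : Y} {m : y ⟶ y'}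
    {a : ObjFiber f y} {b : ObjFiber f y'} : hf.transport m a = b ↔ FiberRel f m a b := by
  have h := (hf.existsUnique_fiberRel m a).choose_spec
  exact ⟨fun e => e ▸ h.1, fun e => (h.2 b e).symm⟩

theorem IsDiscFib.transport_id {f : X ⥤ Y} (hf : IsDiscFib f) {y : Y} (a : ObjFiber f y) :
    hf.transport (𝟙 y) a = a := hf.transport_eq_iff.2 (FiberRel.id f a)

theorem IsDiscFib.transport_comp {f : X ⥤ Y} (hf : IsDiscFib f) {y y' y'' : Y} (m : y ⟶ y')
    (m' : y' ⟶ y'') (a : ObjFiber f y) :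
    hf.transport (m ≫ m') a = hf.transport m' (hf.transport m a) :=
  hf.transport_eq_iff.2 ((hf.transport_eq_iff.1 rfl).comp (hf.transport_eq_iff.1 rfl))

/-- Transport between fibers of a discrete fibration, as a bijection. -/
@[simps]
noncomputable def IsDiscFib.transportEquiv {f : X ⥤ Y} (hf : IsDiscFib f) {y y' : Y}
    (m : y ⟶ y') : ObjFiber f y ≃ ObjFiber f y' where
  toFun := hf.transport m
  invFun := hf.transport (Groupoid.inv m)
  left_inv a := by rw [← hf.transport_comp, Groupoid.comp_inv, hf.transport_id]
  right_inv a := by rw [← hf.transport_comp, Groupoid.inv_comp, hf.transport_id]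

end Fibers

namespace GpdInv

theorem inv_obj_inv_obj (X : GpdInv.{v, u}) (x : X.carrier) : X.inv.obj (X.inv.obj x) = x :=
  Functor.congr_obj X.inv_inv x

variable {X Y : GpdInv.{v, u}} (f : X ⟶ Y)

theorem map_inv_obj (x : X.carrier) : f.1.obj (X.inv.obj x) = Y.inv.obj (f.1.obj x) :=
  Functor.congr_obj (hom_comm f) x

/-- The involution between the fibers over `y` and over its conjugate `z`. -/
def fiberInv {y z : Y.carrier} (h : Y.inv.obj y = z) : ObjFiber f.1 y ≃ ObjFiber f.1 z where
  toFun a := ⟨X.inv.obj a.1, by rw [map_inv_obj, a.2, h]⟩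
  invFun a := ⟨X.inv.obj a.1, by rw [map_inv_obj, a.2, ← h, inv_obj_inv_obj]⟩
  left_inv a := Subtype.ext (inv_obj_inv_obj X a.1)
  right_inv a := Subtype.ext (inv_obj_inv_obj X a.1)

theorem fiberRel_fiberInv {y y' : Y.carrier} {m : y ⟶ y'} {a : ObjFiber f.1 y}
    {b : ObjFiber f.1 y'} (h : FiberRel f.1 m a b) :
    FiberRel f.1 (Y.inv.map m) (fiberInv f rfl a) (fiberInv f rfl b) := by
  obtain ⟨n, hn⟩ := h
  refine ⟨X.inv.map n, ?_⟩
  have := Functor.congr_hom (hom_comm f) n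
  simp only [Functor.comp_map, hn, Functor.map_comp, eqToHom_map] at this
  exact this.trans (by simp; rfl)

end GpdInv

/-! ### The classifying functor of a discrete fibration with small fibers -/

section Classifying

variable {κ : Cardinal.{u}} {X Y : GpdInv.{u, u + 1}} (f : X ⟶ Y) (hf : IsDiscFib f.1)
  (S : Y.carrier → Type u) (ι : ∀ y, ObjFiber f.1 y ≃ S y)

/-- The involution between small models of fibers. -/
def smallFiberInv {y z : Y.carrier} (h : Y.inv.obj y = z) : S y ≃ S z :=
  (ι y).symm.trans ((GpdInv.fiberInv f h).trans (ι z))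

/-- The classifying object of a fiber, given with its conjugate. -/
def classifyingObj (hS : ∀ y, Cardinal.mk (S y) < κ) (y z : Y.carrier) (h : Y.inv.obj y = z) :
    UObj κ := ⟨S y, S z, hS y, hS z, smallFiberInv f S ι h⟩

/-- Transport between small models of fibers. -/
noncomputable def smallTransport {y y' : Y.carrier} (m : y ⟶ y') : S y ≃ S y' :=
  (ι y).symm.trans ((hf.transportEquiv m).trans (ι y'))

theorem smallTransport_fiberInv {y y' : Y.carrier} (m : y ⟶ y') (a : S y) :
    smallFiberInv f S ι rfl (smallTransport f hf S ι m a) =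
      smallTransport f hf S ι (Y.inv.map m) (smallFiberInv f S ι rfl a) := by
  simp only [smallFiberInv, smallTransport, Equiv.trans_apply, Equiv.symm_apply_apply,
    IsDiscFib.transportEquiv_apply]
  congr 1
  exact (hf.transport_eq_iff.2
    (GpdInv.fiberRel_fiberInv f (hf.transport_eq_iff.1 rfl))).symm

/-- The functor to the universe classifying a discrete fibration with small fibers. -/
noncomputable def classifyingFunctor (hS : ∀ y, Cardinal.mk (S y) < κ) :
    Y.carrier ⥤ UObj κ where
  obj y := classifyingObj f S ι hS y _ rfl
  map m := ⟨(smallTransport f hf S ι m, smallTransport f hf S ι (Y.inv.map m)),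
    smallTransport_fiberInv f hf S ι m⟩
  map_id y := UObj.hom_ext (Equiv.ext fun a => by
    change ι y (hf.transport (𝟙 y) ((ι y).symm a)) = a
    rw [hf.transport_id]
    exact (ι y).apply_symm_apply a)
  map_comp {y y' y''} m m' := UObj.hom_ext (Equiv.ext fun a => by
    change ι y'' (hf.transport (m ≫ m') ((ι y).symm a)) =
      ι y'' (hf.transport m' ((ι y').symm (ι y' (hf.transport m ((ι y).symm a)))))
    rw [hf.transport_comp, Equiv.symm_apply_apply])

theorem classifyingFunctor_equivariant (hS : ∀ y, Cardinal.mk (S y) < κ) :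
    Y.inv ⋙ classifyingFunctor f hf S ι hS = classifyingFunctor f hf S ι hS ⋙ Uinv κ := by
  have hobj : ∀ y, classifyingObj f S ι hS (Y.inv.obj y) _ rfl =
      classifyingObj f S ι hS (Y.inv.obj y) y (Y.inv_obj_inv_obj y) := by
    intro y
    have key : ∀ (y z : Y.carrier) (h : Y.inv.obj y = z),
        classifyingObj f S ι hS y _ rfl = classifyingObj f S ι hS y z h := by
      rintro y _ rfl
      rfl
    exact key _ _ _
  exact Functor.hext hobj fun y y' m => UObj.hom_heq (hobj y) (hobj y') HEq.rfl

/-- The classifying functor as a morphism of groupoids with involution. -/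
noncomputable def classifyingMap (hS : ∀ y, Cardinal.mk (S y) < κ) : Y ⟶ UGpd κ :=
  ⟨classifyingFunctor f hf S ι hS, classifyingFunctor_equivariant f hf S ι hS⟩

/-- The functor to the pointed universe covering the classifying functor. -/
noncomputable def pointedClassifyingFunctor (hS : ∀ y, Cardinal.mk (S y) < κ) :
    X.carrier ⥤ UtObj κ where
  obj x := ⟨(classifyingFunctor f hf S ι hS).obj (f.1.obj x), ι _ ⟨x, rfl⟩, _, rfl⟩
  map {x x'} n := ⟨(classifyingFunctor f hf S ι hS).map (f.1.map n), by
    change ι _ (hf.transport (f.1.map n) ((ι _).symm (ι _ ⟨x, rfl⟩))) = ι _ ⟨x', rfl⟩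
    rw [Equiv.symm_apply_apply]
    exact congrArg _ (hf.transport_eq_iff.2 ⟨n, by simp⟩)⟩
  map_id x := Subtype.ext ((f.1 ⋙ classifyingFunctor f hf S ι hS).map_id x)
  map_comp n n' := Subtype.ext ((f.1 ⋙ classifyingFunctor f hf S ι hS).map_comp n n')

variable {S} in
theorem heq_smallFiber_iff {y y' : Y.carrier} (h : y = y') (a : ObjFiber f.1 y)
    (a' : ObjFiber f.1 y') : HEq (ι y a) (ι y' a') ↔ a.1 = a'.1 := by
  subst h
  rw [heq_iff_eq, (ι y).apply_eq_iff_eq, Subtype.ext_iff]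

theorem pointedClassifyingFunctor_equivariant (hS : ∀ y, Cardinal.mk (S y) < κ) :
    X.inv ⋙ pointedClassifyingFunctor f hf S ι hS =
      pointedClassifyingFunctor f hf S ι hS ⋙ Utinv κ := by
  refine UtObj.functor_ext ?_ fun x => ?_
  · change (X.inv ⋙ f.1) ⋙ classifyingFunctor f hf S ι hS =
      f.1 ⋙ (classifyingFunctor f hf S ι hS ⋙ Uinv κ)
    rw [GpdInv.hom_comm, ← classifyingFunctor_equivariant, Functor.assoc]
  · change HEq (ι _ ⟨X.inv.obj x, rfl⟩) (ι _ (GpdInv.fiberInv f rfl ((ι _).symm (ι _ ⟨x, rfl⟩))))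
    rw [heq_smallFiber_iff f ι (GpdInv.map_inv_obj f x), Equiv.symm_apply_apply]
    rfl

/-- The pointed classifying functor as a morphism of groupoids with involution. -/
noncomputable def pointedClassifyingMap (hS : ∀ y, Cardinal.mk (S y) < κ) : X ⟶ UtGpd κ :=
  ⟨pointedClassifyingFunctor f hf S ι hS, pointedClassifyingFunctor_equivariant f hf S ι hS⟩

theorem isStrictPullback_pointedClassifyingFunctor (hS : ∀ y, Cardinal.mk (S y) < κ) :
    IsStrictPullback (pointedClassifyingFunctor f hf S ι hS) f.1 (pFun κ)
      (classifyingFunctor f hf S ι hS) where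
  comm := rfl
  exists_obj y z hz := by
    obtain ⟨z, a, _, rfl⟩ := z
    change z = _ at hz
    subst hz
    obtain ⟨⟨x, rfl⟩, rfl⟩ := (ι y).surjective a
    exact ⟨x, rfl, rfl⟩
  obj_ext x x' h h' := by
    have hpt : ∀ {z z' : UtObj κ}, z = z' → HEq z.pt z'.pt := by rintro z _ rfl; rfl
    exact (heq_smallFiber_iff f ι h ⟨x, rfl⟩ ⟨x', rfl⟩).1 (hpt h')
  exists_map x x' m q hq := by
    have hq' : q.1 = (classifyingFunctor f hf S ι hS).map m := eq_of_heq hq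
    have h : ι _ (hf.transport m ((ι _).symm (ι _ ⟨x, rfl⟩))) = ι _ ⟨x', rfl⟩ := by
      have := q.2
      rw [hq'] at this
      exact this
    rw [Equiv.symm_apply_apply, (ι _).apply_eq_iff_eq, hf.transport_eq_iff] at h
    obtain ⟨n, hn⟩ := h
    have hn' : f.1.map n = m := by simpa using hn
    exact ⟨n, hn', Subtype.ext (by rw [hq', ← hn']; rfl)⟩
  map_ext _ _ _ _ h _ := hf.map_injective h

end Classifying

/-- a morphism of groupoids with involution is a pullback of
p : Ũ → U iff its underlying functor is a discrete fibration with κ-small fibers. -/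
theorem stmt13 (κ : Cardinal.{u}) (hκ : κ.IsInaccessible)
    (X Y : GpdInv.{u, u + 1}) (f : X ⟶ Y) :
    (∃ (g : Y ⟶ UGpd κ) (t : X ⟶ UtGpd κ), IsPullback t f (pMor κ) g) ↔
    (IsDiscFib f.1 ∧
      ∀ b : Y.carrier, Cardinal.mk {x : X.carrier // f.1.obj x = b} <
        Cardinal.lift.{u + 1} κ) := by
  constructor
  · rintro ⟨g, t, H⟩
    exact isDiscFib_of_isPullback H
  · rintro ⟨hf, hS⟩
    have key : ∀ y, ∃ S : Type u, Cardinal.mk S < κ ∧ Nonempty (ObjFiber f.1 y ≃ S) := by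
      intro y
      obtain ⟨c, hc, hc'⟩ := Cardinal.lt_lift_iff.1 (hS y)
      refine ⟨c.out, (Cardinal.mk_out c).trans_lt hc, ?_⟩
      rw [← Cardinal.mk_out c, ← Cardinal.mk_uLift] at hc'
      exact ⟨(Cardinal.eq.1 hc').some.symm.trans Equiv.ulift⟩
    choose S hS ι using key
    exact ⟨classifyingMap f hf S (fun y => (ι y).some) hS,
      pointedClassifyingMap f hf S (fun y => (ι y).some) hS,
      IsStrictPullback.isPullback
        (isStrictPullback_pointedClassifyingFunctor f hf S (fun y => (ι y).some) hS)⟩
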